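/- arXiv:2505.01758 — 5 statements merged into one kernel-verified Lean document; each statement's English description precedes it below -/
import Mathlib

section
/- Let n, m be positive integers, Â ∈ ℝ^{n×n}, B ∈ ℝ^{n×m}, γ ∈ ℝ, and let 𝒳, 𝒳_k ∈ ℝ^{n×n} be symmetric positive definite. Define L = 𝒳_k⁻¹ − 𝒳_k⁻¹(𝒳 − 𝒳_k)𝒳_k⁻¹. If the 4×4 block symmetric matrix [[𝒳, 0, Â, B],[0, γ² I_n, I_n, 0],[Âᵀ, I_n, L, 0],[Bᵀ, 0, 0, I_m]] is positive definite, then the same block matrix with L replaced by 𝒳⁻¹, namely [[𝒳, 0, Â, B],[0, γ² I_n, I_n, 0],[Âᵀ, I_n, 𝒳⁻¹, 0],[Bᵀ, 0, 0, I_m]], is also positive definite. -/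
open Matrix

/-- The 4×4 block symmetric matrix
`[[𝒳, 0, Â, B],[0, γ² Iₙ, Iₙ, 0],[Âᵀ, Iₙ, Y, 0],[Bᵀ, 0, 0, Iₘ]]`,
with the `(3,3)` block given by `Y`. -/
noncomputable def lmiBlock (n m : ℕ) (Ahat : Matrix (Fin n) (Fin n) ℝ)
    (B : Matrix (Fin n) (Fin m) ℝ) (γ : ℝ) (𝒳 Y : Matrix (Fin n) (Fin n) ℝ) :
    Matrix ((Fin n ⊕ Fin n) ⊕ (Fin n ⊕ Fin m)) ((Fin n ⊕ Fin n) ⊕ (Fin n ⊕ Fin m)) ℝ :=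
  Matrix.fromBlocks
    (Matrix.fromBlocks 𝒳 0 0 (γ ^ 2 • (1 : Matrix (Fin n) (Fin n) ℝ)))
    (Matrix.fromBlocks Ahat B (1 : Matrix (Fin n) (Fin n) ℝ) (0 : Matrix (Fin n) (Fin m) ℝ))
    (Matrix.fromBlocks Ahatᵀ (1 : Matrix (Fin n) (Fin n) ℝ) Bᵀ (0 : Matrix (Fin m) (Fin n) ℝ))
    (Matrix.fromBlocks Y 0 0 (1 : Matrix (Fin m) (Fin m) ℝ))

/-- The inverse of a positive definite matrix dominates its linearization at any positive
definite matrix. -/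
theorem Matrix.PosDef.posSemidef_inv_sub_linearization {ι : Type*} [Fintype ι] [DecidableEq ι]
    {X K : Matrix ι ι ℝ} (hX : X.PosDef) (hK : K.PosDef) :
    (X⁻¹ - (K⁻¹ - K⁻¹ * (X - K) * K⁻¹)).PosSemidef := by
  have hXu := (Matrix.isUnit_iff_isUnit_det X).mp hX.isUnit
  have hKu := (Matrix.isUnit_iff_isUnit_det K).mp hK.isUnit
  have key : X⁻¹ - (K⁻¹ - K⁻¹ * (X - K) * K⁻¹) = (X⁻¹ - K⁻¹)ᴴ * X * (X⁻¹ - K⁻¹) := by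
    rw [(hX.inv.isHermitian.sub hK.inv.isHermitian).eq]
    simp only [mul_sub, sub_mul, Matrix.nonsing_inv_mul _ hXu, Matrix.nonsing_inv_mul _ hKu,
      Matrix.mul_nonsing_inv_cancel_right _ _ hXu, Matrix.one_mul]
    abel
  exact key ▸ hX.posSemidef.conjTranspose_mul_mul_same _

theorem Matrix.PosSemidef.fromBlocks_zero_left {ι κ : Type*} [Fintype ι] [Fintype κ]
    [DecidableEq κ] {D : Matrix κ κ ℝ} (hD : D.PosSemidef) :
    (Matrix.fromBlocks (0 : Matrix ι ι ℝ) 0 0 D).PosSemidef := by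
  have key : Matrix.fromBlocks (0 : Matrix ι ι ℝ) 0 0 D =
      (Matrix.fromCols (0 : Matrix κ ι ℝ) 1)ᴴ * D * Matrix.fromCols (0 : Matrix κ ι ℝ) 1 := by
    simp [Matrix.conjTranspose_fromCols_eq_fromRows_conjTranspose, Matrix.fromRows_mul,
      Matrix.mul_fromCols, -Matrix.conjTranspose_eq_transpose_of_trivial]
    ext (i | i) (j | j) <;> simp
  exact key ▸ hD.conjTranspose_mul_mul_same _

theorem Matrix.PosSemidef.fromBlocks_zero_right {ι κ : Type*} [Fintype ι] [Fintype κ]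
    [DecidableEq ι] {A : Matrix ι ι ℝ} (hA : A.PosSemidef) :
    (Matrix.fromBlocks A 0 0 (0 : Matrix κ κ ℝ)).PosSemidef := by
  have key : Matrix.fromBlocks A 0 0 (0 : Matrix κ κ ℝ) =
      (Matrix.fromCols 1 (0 : Matrix ι κ ℝ))ᴴ * A * Matrix.fromCols 1 (0 : Matrix ι κ ℝ) := by
    simp [Matrix.conjTranspose_fromCols_eq_fromRows_conjTranspose, Matrix.fromRows_mul,
      Matrix.mul_fromCols, -Matrix.conjTranspose_eq_transpose_of_trivial]
    ext (i | i) (j | j) <;> simp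
  exact key ▸ hA.conjTranspose_mul_mul_same _

/-- If the 4×4 block LMI with the `(3,3)` block equal to the linearization
`L = 𝒳ₖ⁻¹ - 𝒳ₖ⁻¹ (𝒳 - 𝒳ₖ) 𝒳ₖ⁻¹` of the inverse at `𝒳ₖ` is positive definite, then the LMI
with the `(3,3)` block equal to `𝒳⁻¹` is also positive definite. -/
theorem stmt_4 (n m : ℕ) (hn : 0 < n) (hm : 0 < m)
    (Ahat : Matrix (Fin n) (Fin n) ℝ) (B : Matrix (Fin n) (Fin m) ℝ) (γ : ℝ)
    (𝒳 𝒳k : Matrix (Fin n) (Fin n) ℝ) (h𝒳 : 𝒳.PosDef) (h𝒳k : 𝒳k.PosDef)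
    (h : (lmiBlock n m Ahat B γ 𝒳 (𝒳k⁻¹ - 𝒳k⁻¹ * (𝒳 - 𝒳k) * 𝒳k⁻¹)).PosDef) :
    (lmiBlock n m Ahat B γ 𝒳 𝒳⁻¹).PosDef := by
  have hD := (h𝒳.posSemidef_inv_sub_linearization h𝒳k).fromBlocks_zero_right (κ := Fin m)
  convert h.add_posSemidef (hD.fromBlocks_zero_left (ι := Fin n ⊕ Fin n)) using 1
  simp [lmiBlock, Matrix.fromBlocks_add]
end

section
/- Let T, p, m be positive integers and let P ∈ ℝ^{T×p}, D ∈ ℝ^{T×m} satisfy rank(Pᵀ D) = min(m, p). Then every matrix Δ ∈ ℝ^{p×m} satisfying P Δ = 0 and D Δᵀ = 0 must be the zero matrix. -/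
open Matrix

/-- A matrix annihilated on the left by a matrix of full column rank is zero. -/
lemma eq_zero_of_mul_eq_zero_of_le_rank {K l m n : Type*} [Field K] [Finite l] [Fintype m]
    [Fintype n] {A : Matrix l m K} {B : Matrix m n K} (hA : Fintype.card m ≤ A.rank)
    (h : A * B = 0) : B = 0 := by
  classical
  have hB : B.rank = 0 := by
    have := rank_add_rank_le_card_of_mul_eq_zero h
    omega
  rw [Matrix.rank, Submodule.finrank_eq_zero, LinearMap.range_eq_bot] at hB
  exact toLin'.map_eq_zero_iff.mp hB

/-- If `P ∈ ℝ^{T×p}` and `D ∈ ℝ^{T×m}` satisfy `rank (Pᵀ D) = min m p`,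
then any `Δ ∈ ℝ^{p×m}` with `P Δ = 0` and `D Δᵀ = 0` must be zero. -/
theorem stmt_10 (T p m : ℕ) (hT : 0 < T) (hp : 0 < p) (hm : 0 < m)
    (P : Matrix (Fin T) (Fin p) ℝ) (D : Matrix (Fin T) (Fin m) ℝ)
    (hrank : (Pᵀ * D).rank = min m p)
    (Δ : Matrix (Fin p) (Fin m) ℝ) (h1 : P * Δ = 0) (h2 : D * Δᵀ = 0) :
    Δ = 0 := by
  rcases le_total m p with hmp | hpm
  · have hD := rank_mul_le_right Pᵀ D
    rw [hrank, min_eq_left hmp] at hD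
    exact transpose_eq_zero.mp (eq_zero_of_mul_eq_zero_of_le_rank (by simpa using hD) h2)
  · have hP := rank_mul_le_left Pᵀ D
    rw [hrank, min_eq_right hpm, rank_transpose] at hP
    exact eq_zero_of_mul_eq_zero_of_le_rank (by simpa using hP) h1
end

section
/- Let T, p, m be positive integers, M ∈ ℝ^{p×m}, P_1, …, P_p > 0, and let Ω = {Q ∈ ℝ^{T×p} : ‖q_j‖₂² ≤ P_j for every column q_j of Q}. For τ > 0 define L_τ(D, P, Λ) = (1/2)‖D‖_F² − ‖Λ‖_F²/(2τ) + (τ/2)‖M − Pᵀ D + Λ/τ‖_F² for D ∈ ℝ^{T×m}, P ∈ Ω, Λ ∈ ℝ^{p×m}. Let α, β > 0, τ, τ⁺ > 0, and let (D, P, Λ) with P ∈ Ω be given. Suppose: D⁺ ∈ ℝ^{T×m} minimizes D' ↦ L_τ(D', P, Λ) + (α/2)‖D − D'‖_F² over ℝ^{T×m}; P⁺ ∈ Ω minimizes P' ↦ L_τ(D⁺, P', Λ) + (β/2)‖P − P'‖_F² over Ω; and Λ⁺ = Λ + τ (M − (P⁺)ᵀ D⁺). Then L_τ(D, P, Λ)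 − L_{τ⁺}(D⁺, P⁺, Λ⁺) ≥ (α/2)‖D − D⁺‖_F² + (β/2)‖P − P⁺‖_F² − ((τ + τ⁺)/(2τ²)) ‖Λ − Λ⁺‖_F². -/
open Matrix

/-- Squared Frobenius norm `‖M‖_F² = ∑ᵢⱼ Mᵢⱼ²` of a real matrix. -/
def frobSq {a b : ℕ} (M : Matrix (Fin a) (Fin b) ℝ) : ℝ := ∑ i, ∑ j, (M i j) ^ 2

/-- The constraint set `Ω = {Q ∈ ℝ^{T×p} : ‖qⱼ‖₂² ≤ Pⱼ for every column qⱼ}`. -/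
def powSet (T p : ℕ) (Pow : Fin p → ℝ) : Set (Matrix (Fin T) (Fin p) ℝ) :=
  { Q | ∀ j, ∑ t, (Q t j) ^ 2 ≤ Pow j }

/-- The augmented Lagrangian
`L_τ(D, P, Λ) = (1/2)‖D‖_F² − ‖Λ‖_F²/(2τ) + (τ/2)‖M − Pᵀ D + Λ/τ‖_F²`. -/
noncomputable def augLag {T p m : ℕ} (τ : ℝ) (M : Matrix (Fin p) (Fin m) ℝ)
    (D : Matrix (Fin T) (Fin m) ℝ) (P : Matrix (Fin T) (Fin p) ℝ)
    (Λ : Matrix (Fin p) (Fin m) ℝ) : ℝ :=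
  (1 / 2) * frobSq D - frobSq Λ / (2 * τ) + (τ / 2) * frobSq (M - Pᵀ * D + (1 / τ) • Λ)

theorem frobSq_zero {a b : ℕ} : frobSq (0 : Matrix (Fin a) (Fin b) ℝ) = 0 := by
  simp [frobSq]

theorem frobSq_smul {a b : ℕ} (c : ℝ) (A : Matrix (Fin a) (Fin b) ℝ) :
    frobSq (c • A) = c ^ 2 * frobSq A := by
  simp [frobSq, mul_pow, Finset.mul_sum]

theorem frobSq_add {a b : ℕ} (A B : Matrix (Fin a) (Fin b) ℝ) :
    frobSq (A + B) = frobSq A + 2 * (∑ i, ∑ j, A i j * B i j) + frobSq B := by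
  simp only [frobSq, Finset.mul_sum, ← Finset.sum_add_distrib, Matrix.add_apply]
  exact Finset.sum_congr rfl fun i _ => Finset.sum_congr rfl fun j _ => by ring

/-- The augmented Lagrangian in expanded form: objective, multiplier term, quadratic penalty. -/
theorem augLag_eq {T p m : ℕ} {τ : ℝ} (hτ : τ ≠ 0) (M : Matrix (Fin p) (Fin m) ℝ)
    (D : Matrix (Fin T) (Fin m) ℝ) (P : Matrix (Fin T) (Fin p) ℝ)
    (Λ : Matrix (Fin p) (Fin m) ℝ) :
    augLag τ M D P Λ = (1 / 2) * frobSq D + (∑ i, ∑ j, (M - Pᵀ * D) i j * Λ i j) +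
      (τ / 2) * frobSq (M - Pᵀ * D) := by
  have h : ∑ i, ∑ j, (M - Pᵀ * D) i j * ((1 / τ) • Λ) i j =
      (1 / τ) * ∑ i, ∑ j, (M - Pᵀ * D) i j * Λ i j := by
    simp only [Finset.mul_sum, Matrix.smul_apply, smul_eq_mul]
    exact Finset.sum_congr rfl fun i _ => Finset.sum_congr rfl fun j _ => by ring
  rw [augLag, frobSq_add, frobSq_smul, h]
  field_simp
  ring

/-- The exact change of the augmented Lagrangian under the multiplier and step-size update. -/
theorem augLag_sub_augLag_dual_update {T p m : ℕ} {τ τ' : ℝ} (hτ : τ ≠ 0) (hτ' : τ' ≠ 0)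
    (M : Matrix (Fin p) (Fin m) ℝ) (D : Matrix (Fin T) (Fin m) ℝ)
    (P : Matrix (Fin T) (Fin p) ℝ) (Λ : Matrix (Fin p) (Fin m) ℝ) :
    augLag τ M D P Λ - augLag τ' M D P (Λ + τ • (M - Pᵀ * D)) =
      -((τ + τ') / 2 * frobSq (M - Pᵀ * D)) := by
  rw [augLag_eq hτ, augLag_eq hτ']
  generalize M - Pᵀ * D = R
  have h : ∑ i, ∑ j, R i j * (Λ + τ • R) i j = (∑ i, ∑ j, R i j * Λ i j) + τ * frobSq R := by
    simp only [frobSq, Finset.mul_sum, ← Finset.sum_add_distrib, Matrix.add_apply,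
      Matrix.smul_apply, smul_eq_mul]
    exact Finset.sum_congr rfl fun i _ => Finset.sum_congr rfl fun j _ => by ring
  rw [h]
  ring

/-- One iteration of the proximally modified ADMM (proximal weights
`α, β > 0`, step size `τ > 0`, next step size `τ⁺ > 0`) — where `D⁺` minimizes the
proximally regularized Lagrangian in `D`, `P⁺` minimizes it in `P` over `Ω`, and
`Λ⁺ = Λ + τ (M − (P⁺)ᵀ D⁺)` — satisfies the pseudo-descent bound
`L_τ(D, P, Λ) − L_{τ⁺}(D⁺, P⁺, Λ⁺) ≥
  (α/2)‖D − D⁺‖_F² + (β/2)‖P − P⁺‖_F² − ((τ + τ⁺)/(2τ²))‖Λ − Λ⁺‖_F²`. -/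
theorem stmt_11 (T p m : ℕ) (hT : 0 < T) (hp : 0 < p) (hm : 0 < m)
    (M : Matrix (Fin p) (Fin m) ℝ) (Pow : Fin p → ℝ) (hPow : ∀ j, 0 < Pow j)
    (α β τ τ' : ℝ) (hα : 0 < α) (hβ : 0 < β) (hτ : 0 < τ) (hτ' : 0 < τ')
    (D D' : Matrix (Fin T) (Fin m) ℝ) (P P' : Matrix (Fin T) (Fin p) ℝ)
    (Λ Λ' : Matrix (Fin p) (Fin m) ℝ)
    (hP : P ∈ powSet T p Pow) (hP' : P' ∈ powSet T p Pow)
    (hDmin : ∀ E : Matrix (Fin T) (Fin m) ℝ,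
      augLag τ M D' P Λ + (α / 2) * frobSq (D - D') ≤
        augLag τ M E P Λ + (α / 2) * frobSq (D - E))
    (hPmin : ∀ Q ∈ powSet T p Pow,
      augLag τ M D' P' Λ + (β / 2) * frobSq (P - P') ≤
        augLag τ M D' Q Λ + (β / 2) * frobSq (P - Q))
    (hΛ' : Λ' = Λ + τ • (M - P'ᵀ * D')) :
    augLag τ M D P Λ - augLag τ' M D' P' Λ' ≥
      (α / 2) * frobSq (D - D') + (β / 2) * frobSq (P - P') -
        ((τ + τ') / (2 * τ ^ 2)) * frobSq (Λ - Λ') := by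
  subst hΛ'
  have hD := hDmin D
  have hQ := hPmin P hP
  have hL := augLag_sub_augLag_dual_update hτ.ne' hτ'.ne' M D' P' Λ
  have hR : frobSq (Λ - (Λ + τ • (M - P'ᵀ * D'))) = τ ^ 2 * frobSq (M - P'ᵀ * D') := by
    rw [sub_add_cancel_left, ← neg_smul, frobSq_smul, neg_sq]
  have hc : (τ + τ') / (2 * τ ^ 2) * (τ ^ 2 * frobSq (M - P'ᵀ * D')) =
      (τ + τ') / 2 * frobSq (M - P'ᵀ * D') := by
    field_simp
  rw [sub_self, frobSq_zero] at hD hQ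
  rw [hR, hc]
  linarith
end

section
/- Let T, p, m be positive integers, M ∈ ℝ^{p×m}, P_1, …, P_p > 0, Ω = {Q ∈ ℝ^{T×p} : ‖q_j‖₂² ≤ P_j for every column q_j of Q}, and for τ > 0 define L_τ(D, P, Λ) = (1/2)‖D‖_F² − ‖Λ‖_F²/(2τ) + (τ/2)‖M − Pᵀ D + Λ/τ‖_F². Fix α, β > 0 and sequences D^{(k)} ∈ ℝ^{T×m}, P^{(k)} ∈ Ω, Λ^{(k)} ∈ ℝ^{p×m}, τ^{(k)} > 0 such that for every k: D^{(k+1)} minimizes D' ↦ L_{τ^{(k)}}(D', P^{(k)}, Λ^{(k)}) + (α/2)‖D^{(k)} − D'‖_F² over ℝ^{T×m}; P^{(k+1)} minimizes P' ↦ L_{τ^{(k)}}(D^{(k+1)}, P', Λ^{(k)}) + (β/2)‖P^{(k)} − P'‖_F² over Ω; and Λ^{(k+1)} = Λ^{(k)} + τ^{(k)} (M − (P^{(k+1)})ᵀ D^{(k+1)}). Assume furthermore that ‖Λ^{(k)}‖_F ≤ M₀ for all k and some constant M₀, that τ^{(k)} ≤ τ^{(k+1)} ≤ C τ^{(k)}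 for all k and some constant C > 0, and that Σ_{k=0}^∞ 1/τ^{(k)} < ∞. Then Σ_{k=0}^∞ ‖D^{(k+1)} − D^{(k)}‖_F² < ∞ and Σ_{k=0}^∞ ‖P^{(k+1)} − P^{(k)}‖_F² < ∞; in particular D^{(k+1)} − D^{(k)} → 0 and P^{(k+1)} − P^{(k)} → 0 as k → ∞. -/
open Matrix

theorem frobSq_nonneg {a b : ℕ} (A : Matrix (Fin a) (Fin b) ℝ) : 0 ≤ frobSq A :=
  Finset.sum_nonneg fun _ _ => Finset.sum_nonneg fun _ _ => sq_nonneg _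

theorem frobSq_sub_comm {a b : ℕ} (A B : Matrix (Fin a) (Fin b) ℝ) :
    frobSq (A - B) = frobSq (B - A) := by
  simp only [frobSq, Matrix.sub_apply, sub_sq_comm]

theorem frobSq_add_le {a b : ℕ} (A B : Matrix (Fin a) (Fin b) ℝ) :
    frobSq (A + B) ≤ 2 * (frobSq A + frobSq B) := by
  simp only [frobSq, ← Finset.sum_add_distrib, Finset.mul_sum, Matrix.add_apply]
  exact Finset.sum_le_sum fun _ _ => Finset.sum_le_sum fun _ _ => add_sq_le

theorem frobSq_sub_le {a b : ℕ} (A B : Matrix (Fin a) (Fin b) ℝ) :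
    frobSq (A - B) ≤ 2 * (frobSq A + frobSq B) := by
  simpa [sub_eq_add_neg, frobSq] using frobSq_add_le A (-B)

theorem sq_apply_le_frobSq {a b : ℕ} (A : Matrix (Fin a) (Fin b) ℝ) (i : Fin a) (j : Fin b) :
    (A i j) ^ 2 ≤ frobSq A :=
  (Finset.single_le_sum (f := fun j => (A i j) ^ 2) (fun _ _ => sq_nonneg _)
    (Finset.mem_univ j)).trans
    (Finset.single_le_sum (f := fun i => ∑ j, (A i j) ^ 2)
      (fun _ _ => Finset.sum_nonneg fun _ _ => sq_nonneg _) (Finset.mem_univ i))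

/-- Matrices whose squared Frobenius norms are summable tend to `0`. -/
theorem tendsto_zero_of_summable_frobSq {a b : ℕ} {A : ℕ → Matrix (Fin a) (Fin b) ℝ}
    (h : Summable fun k => frobSq (A k)) : Filter.Tendsto A Filter.atTop (nhds 0) := by
  refine tendsto_pi_nhds.2 fun i => tendsto_pi_nhds.2 fun j => ?_
  have hsq : Filter.Tendsto (fun k => (A k i j) ^ 2) Filter.atTop (nhds 0) :=
    squeeze_zero (fun _ => sq_nonneg _) (fun k => sq_apply_le_frobSq (A k) i j)
      h.tendsto_atTop_zero
  have habs := hsq.sqrt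
  simp only [Real.sqrt_sq_eq_abs, Real.sqrt_zero] at habs
  exact (tendsto_zero_iff_abs_tendsto_zero _).2 habs

/-- A nonnegative sequence dominated by the decrements of a nonnegative sequence plus a summable
error is summable. -/
theorem summable_of_le_sub_add {u v e : ℕ → ℝ} (hu : ∀ k, 0 ≤ u k) (hv : ∀ k, 0 ≤ v k)
    (he₀ : ∀ k, 0 ≤ e k) (he : Summable e) (h : ∀ k, u k ≤ v k - v (k + 1) + e k) :
    Summable u := by
  refine summable_of_sum_range_le (c := v 0 + ∑' k, e k) hu fun n => ?_
  calc ∑ k ∈ Finset.range n, u k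
      ≤ ∑ k ∈ Finset.range n, (v k - v (k + 1) + e k) := Finset.sum_le_sum fun k _ => h k
    _ = v 0 - v n + ∑ k ∈ Finset.range n, e k := by
      rw [Finset.sum_add_distrib, Finset.sum_range_sub']
    _ ≤ v 0 + ∑' k, e k := by
      have := he.sum_le_tsum (Finset.range n) fun k _ => he₀ k
      linarith [hv n]

/-- The augmented Lagrangian is bounded below by its objective part up to a term of order `1/τ`. -/
theorem le_augLag {T p m : ℕ} {τ : ℝ} (hτ : 0 < τ) (M : Matrix (Fin p) (Fin m) ℝ)
    (D : Matrix (Fin T) (Fin m) ℝ) (P : Matrix (Fin T) (Fin p) ℝ)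
    (Λ : Matrix (Fin p) (Fin m) ℝ) :
    (1 / 2) * frobSq D - frobSq Λ / (2 * τ) ≤ augLag τ M D P Λ :=
  le_add_of_nonneg_right (mul_nonneg (by positivity) (frobSq_nonneg _))

theorem augLag_le {T p m : ℕ} {τ : ℝ} (hτ : 0 < τ) (M : Matrix (Fin p) (Fin m) ℝ)
    (D : Matrix (Fin T) (Fin m) ℝ) (P : Matrix (Fin T) (Fin p) ℝ)
    (Λ : Matrix (Fin p) (Fin m) ℝ) :
    augLag τ M D P Λ ≤ (1 / 2) * frobSq D - frobSq Λ / (2 * τ)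
      + (τ * frobSq (M - Pᵀ * D) + frobSq Λ / τ) := by
  have h := mul_le_mul_of_nonneg_left (frobSq_add_le (M - Pᵀ * D) ((1 / τ) • Λ))
    (by positivity : 0 ≤ τ / 2)
  rw [frobSq_smul] at h
  have h₂ : τ / 2 * (2 * (frobSq (M - Pᵀ * D) + (1 / τ) ^ 2 * frobSq Λ))
      = τ * frobSq (M - Pᵀ * D) + frobSq Λ / τ := by
    field_simp
  rw [h₂] at h
  exact add_le_add_right h _

/-- Along the iterates of the proximally modified ADMM (with proximal
weights `α, β > 0`), if the dual variables stay bounded (`‖Λ⁽ᵏ⁾‖_F ≤ M₀`), the step sizes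
are nondecreasing with bounded ratio (`τ⁽ᵏ⁾ ≤ τ⁽ᵏ⁺¹⁾ ≤ C τ⁽ᵏ⁾`) and `∑ₖ 1/τ⁽ᵏ⁾ < ∞`,
then `∑ₖ ‖D⁽ᵏ⁺¹⁾ − D⁽ᵏ⁾‖_F² < ∞` and `∑ₖ ‖P⁽ᵏ⁺¹⁾ − P⁽ᵏ⁾‖_F² < ∞`; in particular the
increments `D⁽ᵏ⁺¹⁾ − D⁽ᵏ⁾` and `P⁽ᵏ⁺¹⁾ − P⁽ᵏ⁾` tend to `0`. -/
theorem stmt_13 (T p m : ℕ) (hT : 0 < T) (hp : 0 < p) (hm : 0 < m)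
    (M : Matrix (Fin p) (Fin m) ℝ) (Pow : Fin p → ℝ) (hPow : ∀ j, 0 < Pow j)
    (α β : ℝ) (hα : 0 < α) (hβ : 0 < β)
    (D : ℕ → Matrix (Fin T) (Fin m) ℝ) (P : ℕ → Matrix (Fin T) (Fin p) ℝ)
    (Λ : ℕ → Matrix (Fin p) (Fin m) ℝ) (τ : ℕ → ℝ) (hτpos : ∀ k, 0 < τ k)
    (hPmem : ∀ k, P k ∈ powSet T p Pow)
    (hDmin : ∀ k, ∀ E : Matrix (Fin T) (Fin m) ℝ,
      augLag (τ k) M (D (k + 1)) (P k) (Λ k) + (α / 2) * frobSq (D k - D (k + 1)) ≤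
        augLag (τ k) M E (P k) (Λ k) + (α / 2) * frobSq (D k - E))
    (hPmin : ∀ k, ∀ Q ∈ powSet T p Pow,
      augLag (τ k) M (D (k + 1)) (P (k + 1)) (Λ k) + (β / 2) * frobSq (P k - P (k + 1)) ≤
        augLag (τ k) M (D (k + 1)) Q (Λ k) + (β / 2) * frobSq (P k - Q))
    (hΛ : ∀ k, Λ (k + 1) = Λ k + τ k • (M - (P (k + 1))ᵀ * D (k + 1)))
    (M₀ : ℝ) (hΛbd : ∀ k, Real.sqrt (frobSq (Λ k)) ≤ M₀)
    (C : ℝ) (hCpos : 0 < C)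
    (hτmono : ∀ k, τ k ≤ τ (k + 1)) (hτratio : ∀ k, τ (k + 1) ≤ C * τ k)
    (hτsum : Summable (fun k => 1 / τ k)) :
    Summable (fun k => frobSq (D (k + 1) - D k)) ∧
    Summable (fun k => frobSq (P (k + 1) - P k)) ∧
    Filter.Tendsto (fun k => D (k + 1) - D k) Filter.atTop (nhds 0) ∧
    Filter.Tendsto (fun k => P (k + 1) - P k) Filter.atTop (nhds 0) := by
  have hΛsq (k) : frobSq (Λ k) ≤ M₀ ^ 2 := (Real.sqrt_le_iff.1 (hΛbd k)).2
  have hres (k) : τ (k + 1) * frobSq (M - (P (k + 1))ᵀ * D (k + 1))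
      ≤ 4 * M₀ ^ 2 * C ^ 2 * (1 / τ (k + 1)) := by
    have hk := hτpos k
    have hk' := hτpos (k + 1)
    have h₁ : τ k ^ 2 * frobSq (M - (P (k + 1))ᵀ * D (k + 1)) ≤ 4 * M₀ ^ 2 := by
      rw [← frobSq_smul, ← sub_eq_of_eq_add' (hΛ k)]
      linarith [frobSq_sub_le (Λ (k + 1)) (Λ k), hΛsq k, hΛsq (k + 1)]
    have h₂ : τ (k + 1) ^ 2 ≤ C ^ 2 * τ k ^ 2 := by
      rw [← mul_pow]
      exact pow_le_pow_left₀ hk'.le (hτratio k) 2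
    rw [mul_one_div, le_div_iff₀ hk']
    calc τ (k + 1) * frobSq (M - (P (k + 1))ᵀ * D (k + 1)) * τ (k + 1)
        = τ (k + 1) ^ 2 * frobSq (M - (P (k + 1))ᵀ * D (k + 1)) := by ring
      _ ≤ C ^ 2 * τ k ^ 2 * frobSq (M - (P (k + 1))ᵀ * D (k + 1)) :=
        mul_le_mul_of_nonneg_right h₂ (frobSq_nonneg _)
      _ = C ^ 2 * (τ k ^ 2 * frobSq (M - (P (k + 1))ᵀ * D (k + 1))) := by ring
      _ ≤ C ^ 2 * (4 * M₀ ^ 2) := mul_le_mul_of_nonneg_left h₁ (sq_nonneg C)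
      _ = 4 * M₀ ^ 2 * C ^ 2 := by ring
  have hdesc (k) : (α / 2) * frobSq (D (k + 1) - D k) + (β / 2) * frobSq (P (k + 1) - P k)
      ≤ augLag (τ k) M (D k) (P k) (Λ k) - augLag (τ k) M (D (k + 1)) (P (k + 1)) (Λ k) := by
    have h₁ := hDmin k (D k)
    have h₂ := hPmin k (P k) (hPmem k)
    rw [sub_self, frobSq_zero, frobSq_sub_comm] at h₁ h₂
    linarith
  have herr : Summable fun k => (4 * M₀ ^ 2 * C ^ 2 + M₀ ^ 2) * (1 / τ (k + 1)) :=
    ((summable_nat_add_iff (f := fun k => 1 / τ k) 1).2 hτsum).mul_left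
      (4 * M₀ ^ 2 * C ^ 2 + M₀ ^ 2)
  have hsum : Summable fun k => (α / 2) * frobSq (D (k + 1 + 1) - D (k + 1))
      + (β / 2) * frobSq (P (k + 1 + 1) - P (k + 1)) := by
    refine summable_of_le_sub_add (v := fun k => (1 / 2) * frobSq (D (k + 1)))
      (e := fun k => (4 * M₀ ^ 2 * C ^ 2 + M₀ ^ 2) * (1 / τ (k + 1)))
      (fun k => add_nonneg (mul_nonneg (by positivity) (frobSq_nonneg _))
        (mul_nonneg (by positivity) (frobSq_nonneg _)))
      (fun k => mul_nonneg (by norm_num) (frobSq_nonneg _))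
      (fun k => mul_nonneg (by positivity) (one_div_nonneg.2 (hτpos _).le))
      herr fun k => ?_
    have hk := hτpos (k + 1)
    have hΛk : frobSq (Λ (k + 1)) / τ (k + 1) ≤ M₀ ^ 2 * (1 / τ (k + 1)) := by
      rw [mul_one_div]
      exact div_le_div_of_nonneg_right (hΛsq _) hk.le
    linarith [hdesc (k + 1), hres k, hΛk,
      augLag_le hk M (D (k + 1)) (P (k + 1)) (Λ (k + 1)),
      le_augLag hk M (D (k + 1 + 1)) (P (k + 1 + 1)) (Λ (k + 1))]
  have hD : Summable fun k => frobSq (D (k + 1) - D k) := by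
    rw [← summable_nat_add_iff 1, ← summable_mul_left_iff (by positivity : α / 2 ≠ 0)]
    exact hsum.of_nonneg_of_le (fun k => mul_nonneg (by positivity) (frobSq_nonneg _))
      fun k => le_add_of_nonneg_right (mul_nonneg (by positivity) (frobSq_nonneg _))
  have hP : Summable fun k => frobSq (P (k + 1) - P k) := by
    rw [← summable_nat_add_iff 1, ← summable_mul_left_iff (by positivity : β / 2 ≠ 0)]
    exact hsum.of_nonneg_of_le (fun k => mul_nonneg (by positivity) (frobSq_nonneg _))
      fun k => le_add_of_nonneg_left (mul_nonneg (by positivity) (frobSq_nonneg _))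
  exact ⟨hD, hP, tendsto_zero_of_summable_frobSq hD, tendsto_zero_of_summable_frobSq hP⟩
end

section
/- Let T, p, m be positive integers, M ∈ ℝ^{p×m}, P_1, …, P_p > 0, and Ω = {Q ∈ ℝ^{T×p} : ‖q_j‖₂² ≤ P_j for every column q_j of Q}. Let D ∈ ℝ^{T×m}, Λ ∈ ℝ^{p×m}, P ∈ Ω, and τ, β > 0. Suppose P⁺ ∈ Ω minimizes the function Q ↦ (τ/2)‖M − Qᵀ D + Λ/τ‖_F² + (β/2)‖P − Q‖_F² over Ω, and set Λ⁺ = Λ + τ (M − (P⁺)ᵀ D). Then there exist real numbers γ_1, …, γ_p ≥ 0 with γ_j (‖p⁺_j‖₂² − P_j) = 0 for every j (where p⁺_j is the j-th column of P⁺), such that D (Λ⁺)ᵀ = P⁺ diag(γ_1, …, γ_p) + β (P⁺ − P). -/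
open Matrix

theorem frobSq_sub_smul {a b : ℕ} (A B : Matrix (Fin a) (Fin b) ℝ) (s : ℝ) :
    frobSq (A - s • B) = frobSq A - 2 * s * (A * Bᵀ).trace + s ^ 2 * frobSq B := by
  simp only [frobSq, Matrix.trace, Matrix.diag_apply, Matrix.mul_apply, Matrix.transpose_apply,
    Finset.mul_sum, ← Finset.sum_sub_distrib, ← Finset.sum_add_distrib]
  refine Finset.sum_congr rfl fun i _ => Finset.sum_congr rfl fun j _ => ?_
  simp only [Matrix.sub_apply, Matrix.smul_apply, smul_eq_mul]
  ring

theorem nonpos_of_forall_le_mul {a c : ℝ} (hc : 0 ≤ c)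
    (h : ∀ s : ℝ, 0 < s → s ≤ 1 → a ≤ s * c) : a ≤ 0 := by
  by_contra! ha
  have hac : 0 < a + c := by positivity
  have h1 := h (a / (a + c)) (by positivity) ((div_le_one hac).2 (by linarith))
  rw [div_mul_eq_mul_div, le_div_iff₀ hac] at h1
  nlinarith

theorem add_smul_sub_mem_powSet {T p : ℕ} {Pow : Fin p → ℝ} {P Q : Matrix (Fin T) (Fin p) ℝ}
    (hP : P ∈ powSet T p Pow) (hQ : Q ∈ powSet T p Pow) {s : ℝ} (hs : 0 ≤ s) (hs1 : s ≤ 1) :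
    P + s • (Q - P) ∈ powSet T p Pow := by
  intro j
  calc ∑ t, ((P + s • (Q - P)) t j) ^ 2
      ≤ ∑ t, ((1 - s) * (P t j) ^ 2 + s * (Q t j) ^ 2) := by
        refine Finset.sum_le_sum fun t _ => ?_
        simp only [Matrix.add_apply, Matrix.sub_apply, Matrix.smul_apply, smul_eq_mul]
        nlinarith [mul_nonneg (mul_nonneg hs (sub_nonneg.2 hs1)) (sq_nonneg (Q t j - P t j))]
    _ = (1 - s) * ∑ t, (P t j) ^ 2 + s * ∑ t, (Q t j) ^ 2 := by
        rw [Finset.sum_add_distrib, Finset.mul_sum, Finset.mul_sum]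
    _ ≤ (1 - s) * Pow j + s * Pow j :=
        add_le_add (mul_le_mul_of_nonneg_left (hP j) (sub_nonneg.2 hs1))
          (mul_le_mul_of_nonneg_left (hQ j) hs)
    _ = Pow j := by ring

/-- The normal cone of a centred Euclidean ball of squared radius `r`. -/
theorem exists_multiplier_of_ball {ι : Type*} [Fintype ι] {r : ℝ} (hr : 0 < r) (g x : ι → ℝ)
    (hx : ∑ t, x t ^ 2 ≤ r)
    (h : ∀ q : ι → ℝ, ∑ t, q t ^ 2 ≤ r → ∑ t, g t * (q t - x t) ≤ 0) :
    ∃ c : ℝ, 0 ≤ c ∧ c * (∑ t, x t ^ 2 - r) = 0 ∧ ∀ t, g t = c * x t := by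
  have hS : 0 ≤ ∑ t, g t ^ 2 := Finset.sum_nonneg fun _ _ => sq_nonneg _
  rcases hS.eq_or_lt with h0 | hpos
  · refine ⟨0, le_rfl, zero_mul _, fun t => ?_⟩
    have := (Finset.sum_eq_zero_iff_of_nonneg fun t _ => sq_nonneg (g t)).1 h0.symm t
      (Finset.mem_univ t)
    simpa using this
  · obtain ⟨c, hc, hc2⟩ : ∃ c : ℝ, 0 < c ∧ c ^ 2 * r = ∑ t, g t ^ 2 :=
      ⟨√((∑ t, g t ^ 2) / r), Real.sqrt_pos.2 (by positivity), by
        rw [Real.sq_sqrt (by positivity), div_mul_cancel₀ _ hr.ne']⟩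
    have hq := h (fun t => c⁻¹ * g t) (by
      simp only [mul_pow]
      rw [← Finset.mul_sum, ← hc2]
      field_simp
      exact le_rfl)
    have hgx : c * r ≤ ∑ t, g t * x t := by
      have e : ∑ t, g t * (c⁻¹ * g t - x t) = c⁻¹ * ∑ t, g t ^ 2 - ∑ t, g t * x t := by
        rw [Finset.mul_sum, ← Finset.sum_sub_distrib]
        exact Finset.sum_congr rfl fun t _ => by ring
      have e2 : c⁻¹ * (c ^ 2 * r) = c * r := by field_simp
      rw [e, ← hc2, e2] at hq
      linarith
    have e : ∑ t, (g t - c * x t) ^ 2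
        = ∑ t, g t ^ 2 - 2 * c * ∑ t, g t * x t + c ^ 2 * ∑ t, x t ^ 2 := by
      rw [Finset.mul_sum, Finset.mul_sum, ← Finset.sum_sub_distrib, ← Finset.sum_add_distrib]
      exact Finset.sum_congr rfl fun t _ => by ring
    have hnn : 0 ≤ ∑ t, (g t - c * x t) ^ 2 := Finset.sum_nonneg fun _ _ => sq_nonneg _
    have h1 := mul_le_mul_of_nonneg_left hgx hc.le
    have h2 := mul_le_mul_of_nonneg_left hx (sq_nonneg c)
    have hxr : ∑ t, x t ^ 2 = r :=
      mul_left_cancel₀ (pow_pos hc 2).ne' (le_antisymm h2 (by linarith))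
    refine ⟨c, hc.le, by rw [hxr, sub_self, mul_zero], fun t => ?_⟩
    have hz := (Finset.sum_eq_zero_iff_of_nonneg fun t _ => sq_nonneg (g t - c * x t)).1
      (le_antisymm (by linarith) hnn) t (Finset.mem_univ t)
    exact sub_eq_zero.1 (pow_eq_zero_iff two_ne_zero |>.1 hz)

/-- First-order optimality condition of the `P`-update of the modified
ADMM. If `P⁺ ∈ Ω` minimizes `Q ↦ (τ/2)‖M − Qᵀ D + Λ/τ‖_F² + (β/2)‖P − Q‖_F²` over `Ω`
and `Λ⁺ = Λ + τ (M − (P⁺)ᵀ D)`, then there exist multipliers `γ₁, …, γ_p ≥ 0` with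
`γⱼ (‖p⁺ⱼ‖₂² − Pⱼ) = 0` for all `j` such that
`D (Λ⁺)ᵀ = P⁺ diag(γ₁, …, γ_p) + β (P⁺ − P)`. -/
theorem stmt_14 (T p m : ℕ) (hT : 0 < T) (hp : 0 < p) (hm : 0 < m)
    (M : Matrix (Fin p) (Fin m) ℝ) (Pow : Fin p → ℝ) (hPow : ∀ j, 0 < Pow j)
    (D : Matrix (Fin T) (Fin m) ℝ) (Λ : Matrix (Fin p) (Fin m) ℝ)
    (P P' : Matrix (Fin T) (Fin p) ℝ) (τ β : ℝ) (hτ : 0 < τ) (hβ : 0 < β)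
    (hP : P ∈ powSet T p Pow) (hP' : P' ∈ powSet T p Pow)
    (hmin : ∀ Q ∈ powSet T p Pow,
      (τ / 2) * frobSq (M - P'ᵀ * D + (1 / τ) • Λ) + (β / 2) * frobSq (P - P') ≤
        (τ / 2) * frobSq (M - Qᵀ * D + (1 / τ) • Λ) + (β / 2) * frobSq (P - Q))
    (Λ' : Matrix (Fin p) (Fin m) ℝ) (hΛ' : Λ' = Λ + τ • (M - P'ᵀ * D)) :
    ∃ γv : Fin p → ℝ, (∀ j, 0 ≤ γv j) ∧
      (∀ j, γv j * ((∑ t, (P' t j) ^ 2) - Pow j) = 0) ∧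
      D * Λ'ᵀ = P' * Matrix.diagonal γv + β • (P' - P) := by
  have hA : M - P'ᵀ * D + (1 / τ) • Λ = (1 / τ) • Λ' := by
    rw [hΛ', smul_add, smul_smul, one_div_mul_cancel hτ.ne', one_smul, add_comm]
  set G := D * Λ'ᵀ - β • (P' - P) with hG
  have hvar : ∀ Q ∈ powSet T p Pow, (G * (Q - P')ᵀ).trace ≤ 0 := by
    intro Q hQ
    set H := Q - P' with hH
    refine nonpos_of_forall_le_mul
      (c := τ / 2 * frobSq (Hᵀ * D) + β / 2 * frobSq H) ?_ fun s hs hs1 => ?_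
    · have := frobSq_nonneg (Hᵀ * D)
      have := frobSq_nonneg H
      positivity
    have h := hmin _ (add_smul_sub_mem_powSet hP' hQ hs.le hs1)
    have e1 : M - (P' + s • H)ᵀ * D + (1 / τ) • Λ = (1 / τ) • Λ' - s • (Hᵀ * D) := by
      rw [← hA, Matrix.transpose_add, Matrix.transpose_smul, Matrix.add_mul, Matrix.smul_mul]
      abel
    have e2 : P - (P' + s • H) = (P - P') - s • H := by abel
    have e3 : (Λ' * (Hᵀ * D)ᵀ).trace = (D * Λ'ᵀ * Hᵀ).trace := by
      rw [← Matrix.trace_transpose, Matrix.transpose_mul, Matrix.transpose_transpose,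
        Matrix.trace_mul_cycle, Matrix.trace_mul_comm, Matrix.mul_assoc, Matrix.trace_mul_comm]
    have e4 : (G * Hᵀ).trace = (D * Λ'ᵀ * Hᵀ).trace + β * ((P - P') * Hᵀ).trace := by
      rw [hG, Matrix.sub_mul, Matrix.trace_sub, Matrix.smul_mul, Matrix.trace_smul,
        ← neg_sub P P', Matrix.neg_mul, Matrix.trace_neg, smul_eq_mul]
      ring
    rw [← hH, hA, e1, e2, frobSq_sub_smul, frobSq_sub_smul, Matrix.smul_mul, Matrix.trace_smul,
      smul_eq_mul, e3] at h
    rw [e4]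
    have e5 : τ / 2 * (2 * s * (1 / τ * (D * Λ'ᵀ * Hᵀ).trace)) = s * (D * Λ'ᵀ * Hᵀ).trace := by
      field_simp
    refine le_of_mul_le_mul_left ?_ hs
    linarith
  have hcol : ∀ j, ∃ c : ℝ, 0 ≤ c ∧ c * (∑ t, (P' t j) ^ 2 - Pow j) = 0 ∧
      ∀ t, G t j = c * P' t j := by
    intro j
    refine exists_multiplier_of_ball (hPow j) (fun t => G t j) (fun t => P' t j) (hP' j)
      fun q hq => ?_
    have h := hvar (P'.updateCol j q) fun k => by
      rcases eq_or_ne k j with rfl | hk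
      · simpa using hq
      · simpa [hk] using hP' k
    refine le_of_eq_of_le ?_ h
    simp only [Matrix.trace, Matrix.diag_apply, Matrix.mul_apply, Matrix.transpose_apply]
    refine Finset.sum_congr rfl fun t _ => ?_
    rw [Finset.sum_eq_single j]
    · simp [Matrix.sub_apply]
    · intro k _ hk
      simp [Matrix.sub_apply, hk]
    · simp
  choose γv h0 h1 h2 using hcol
  refine ⟨γv, h0, h1, ?_⟩
  rw [← sub_eq_iff_eq_add, ← hG]
  ext t j
  rw [Matrix.mul_diagonal, h2, mul_comm]
end
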